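/- arXiv:2010.08435 — 5 statements merged into one kernel-verified Lean document; each statement's English description precedes it below -/
import Mathlib

section
/- The relation ≤ on Ψ is a partial order: it is reflexive, transitive, and antisymmetric. -/
/-- A functional `r • α + ∑ s γ • γ` with `r > 0` takes at least the value `α v₀` at `v₀`. -/
theorem Module.Dual.apply_le_of_eq_smul_add_sum {V : Type*} [AddCommGroup V] [Module ℝ V]
    {Ψ : Finset (Module.Dual ℝ V)} {v₀ : V} (hv₀ : ∀ α ∈ Ψ, α v₀ > 0)
    {α β : Module.Dual ℝ V} (hα : α ∈ Ψ) {r : ℕ} {s : Module.Dual ℝ V → ℕ} (hr : 0 < r)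
    (hβ : β = (r : ℝ) • α + ∑ γ ∈ Ψ, (s γ : ℝ) • γ) : α v₀ ≤ β v₀ := by
  have hs : 0 ≤ ∑ γ ∈ Ψ, (s γ : ℝ) * γ v₀ :=
    Finset.sum_nonneg fun γ hγ => mul_nonneg (Nat.cast_nonneg _) (hv₀ γ hγ).le
  have hr1 : (1 : ℝ) ≤ r := by exact_mod_cast hr
  have hval : β v₀ = r * α v₀ + ∑ γ ∈ Ψ, (s γ : ℝ) * γ v₀ := by
    simp [hβ, LinearMap.sum_apply]
  nlinarith [hv₀ α hα]

/-- If `r • α + ∑ s γ • γ` with `r > 0` takes the same value as `α` at `v₀`, it equals `α`. -/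
theorem Module.Dual.eq_of_eq_smul_add_sum_of_apply_le {V : Type*} [AddCommGroup V] [Module ℝ V]
    {Ψ : Finset (Module.Dual ℝ V)} {v₀ : V} (hv₀ : ∀ α ∈ Ψ, α v₀ > 0)
    {α β : Module.Dual ℝ V} (hα : α ∈ Ψ) {r : ℕ} {s : Module.Dual ℝ V → ℕ} (hr : 0 < r)
    (hβ : β = (r : ℝ) • α + ∑ γ ∈ Ψ, (s γ : ℝ) • γ) (h : β v₀ ≤ α v₀) : α = β := by
  have hpos := hv₀ α hα
  have hterm : ∀ γ ∈ Ψ, 0 ≤ (s γ : ℝ) * γ v₀ := fun γ hγ =>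
    mul_nonneg (Nat.cast_nonneg _) (hv₀ γ hγ).le
  have hs := Finset.sum_nonneg hterm
  have hr1 : (1 : ℝ) ≤ r := by exact_mod_cast hr
  have hval : β v₀ = r * α v₀ + ∑ γ ∈ Ψ, (s γ : ℝ) * γ v₀ := by
    simp [hβ, LinearMap.sum_apply]
  have hr_eq : (r : ℝ) = 1 := by nlinarith
  have hs_eq : ∑ γ ∈ Ψ, (s γ : ℝ) * γ v₀ = 0 := by rw [hr_eq] at hval; linarith
  have hs_zero : ∑ γ ∈ Ψ, (s γ : ℝ) • γ = 0 := Finset.sum_eq_zero fun γ hγ => by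
    have := (Finset.sum_eq_zero_iff_of_nonneg hterm).mp hs_eq γ hγ
    rw [(mul_eq_zero.mp this).resolve_right (hv₀ γ hγ).ne', zero_smul]
  rw [hβ, hr_eq, hs_zero, one_smul, add_zero]

/-- The relation `≤` on `Ψ` (defined by `α ≤ β` iff
`β = r·α + ∑ s_γ·γ` with `r > 0`, `s_γ ≥ 0`, `γ ∈ Ψ`) is a partial order on `Ψ`:
reflexive, transitive, and antisymmetric. -/
theorem stmt_0 (V : Type*) [AddCommGroup V] [Module ℝ V]
    (Ψ : Finset (Module.Dual ℝ V))
    (v₀ : V) (hv₀ : ∀ α ∈ Ψ, α v₀ > 0)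
    (le : Module.Dual ℝ V → Module.Dual ℝ V → Prop)
    (hle : ∀ α β : Module.Dual ℝ V, le α β ↔
      ∃ (r : ℕ) (s : Module.Dual ℝ V → ℕ), 0 < r ∧
        β = (r : ℝ) • α + ∑ γ ∈ Ψ, (s γ : ℝ) • γ) :
    (∀ α ∈ Ψ, le α α) ∧
    (∀ α ∈ Ψ, ∀ β ∈ Ψ, ∀ γ ∈ Ψ, le α β → le β γ → le α γ) ∧
    (∀ α ∈ Ψ, ∀ β ∈ Ψ, le α β → le β α → α = β) := by
  refine ⟨fun α _ => (hle α α).mpr ⟨1, 0, one_pos, by simp⟩, ?_, ?_⟩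
  · intro α _ β _ γ _ hαβ hβγ
    obtain ⟨r, s, hr, hβ⟩ := (hle α β).mp hαβ
    obtain ⟨q, t, hq, hγ⟩ := (hle β γ).mp hβγ
    refine (hle α γ).mpr ⟨q * r, fun δ => q * s δ + t δ, Nat.mul_pos hq hr, ?_⟩
    rw [hγ, hβ]
    simp only [Nat.cast_add, Nat.cast_mul, add_smul, mul_smul, smul_add, Finset.sum_add_distrib,
      Finset.smul_sum, add_assoc]
  · intro α hα β hβ hαβ hβα
    obtain ⟨r, s, hr, h⟩ := (hle α β).mp hαβ
    obtain ⟨q, t, hq, h'⟩ := (hle β α).mp hβα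
    exact Module.Dual.eq_of_eq_smul_add_sum_of_apply_le hv₀ hα hr h
      (Module.Dual.apply_le_of_eq_smul_add_sum hv₀ hβ hq h')
end

section
/- Fix g ∈ P and coset decompositions Γ_M = ⨆_{i=1}^{μ_M(g_M)} (Γ_M)_{(g_M)}·m_i, (Γ_M)_{(g_M)} = ⨆_{j=1}^{ν_M(g)} pr_M(Γ_{(g)})·h_j, and Γ_U = ⨆_{s=1}^{μ_U(g)} (Γ_U)_{(g)}·u_s. Then the double coset decomposes as ΓgΓ = ⋃_{i}⋃_{j}⋃_{s} Γ·g·u_s·h_j·m_i, and this union is disjoint, i.e. the μ_M(g_M)·ν_M(g)·μ_U(g) right cosets Γ·g·u_s·h_j·m_i are pairwise distinct. -/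
open Pointwise

/-- Given coset decompositions
`Γ_M = ⨆ᵢ (Γ_M)_{(g_M)}·mᵢ`, `(Γ_M)_{(g_M)} = ⨆ⱼ pr_M(Γ_{(g)})·hⱼ`,
`Γ_U = ⨆ₛ (Γ_U)_{(g)}·uₛ`, the double coset decomposes as
`ΓgΓ = ⋃ᵢⱼₛ Γ·g·uₛ·hⱼ·mᵢ`, a disjoint union (the right cosets are pairwise distinct). -/
theorem stmt_1 (P : Type*) [Group P] (U M Γ : Subgroup P) [U.Normal]
    (hMU : M ⊓ U = ⊥) (hP : (M : Set P) * (U : Set P) = Set.univ)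
    (prM : P →* P) (hprM_mem : ∀ g : P, prM g ∈ M)
    (hprM_fix : ∀ m ∈ M, prM m = m) (hprM_U : ∀ u ∈ U, prM u = 1)
    (hΓ : (Γ : Set P) = ((Γ ⊓ M : Subgroup P) : Set P) * ((Γ ⊓ U : Subgroup P) : Set P))
    (g : P) (iM nM iU : ℕ)
    (m : Fin iM → P) (hm : ∀ i, m i ∈ Γ ⊓ M)
    (hmcov : ((Γ ⊓ M : Subgroup P) : Set P) =
      ⋃ i, (fun x => x * m i) '' {x : P | x ∈ Γ ⊓ M ∧ prM g * x * (prM g)⁻¹ ∈ Γ ⊓ M})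
    (hmdisj : ∀ i i' : Fin iM, ∀ x x' : P,
      x ∈ {x : P | x ∈ Γ ⊓ M ∧ prM g * x * (prM g)⁻¹ ∈ Γ ⊓ M} →
      x' ∈ {x : P | x ∈ Γ ⊓ M ∧ prM g * x * (prM g)⁻¹ ∈ Γ ⊓ M} →
      x * m i = x' * m i' → i = i')
    (h : Fin nM → P)
    (hh : ∀ j, h j ∈ {x : P | x ∈ Γ ⊓ M ∧ prM g * x * (prM g)⁻¹ ∈ Γ ⊓ M})
    (hhcov : {x : P | x ∈ Γ ⊓ M ∧ prM g * x * (prM g)⁻¹ ∈ Γ ⊓ M} =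
      ⋃ j, (fun x => x * h j) '' (prM '' {x : P | x ∈ Γ ∧ g * x * g⁻¹ ∈ Γ}))
    (hhdisj : ∀ j j' : Fin nM, ∀ x x' : P,
      x ∈ prM '' {x : P | x ∈ Γ ∧ g * x * g⁻¹ ∈ Γ} →
      x' ∈ prM '' {x : P | x ∈ Γ ∧ g * x * g⁻¹ ∈ Γ} →
      x * h j = x' * h j' → j = j')
    (u : Fin iU → P) (hu : ∀ s, u s ∈ Γ ⊓ U)
    (hucov : ((Γ ⊓ U : Subgroup P) : Set P) =
      ⋃ s, (fun x => x * u s) '' {x : P | x ∈ Γ ⊓ U ∧ g * x * g⁻¹ ∈ Γ ⊓ U})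
    (hudisj : ∀ s s' : Fin iU, ∀ x x' : P,
      x ∈ {x : P | x ∈ Γ ⊓ U ∧ g * x * g⁻¹ ∈ Γ ⊓ U} →
      x' ∈ {x : P | x ∈ Γ ⊓ U ∧ g * x * g⁻¹ ∈ Γ ⊓ U} →
      x * u s = x' * u s' → s = s') :
    ((Γ : Set P) * {g} * (Γ : Set P) =
      ⋃ (i : Fin iM), ⋃ (j : Fin nM), ⋃ (s : Fin iU),
        (Γ : Set P) * {g * u s * h j * m i}) ∧
    (∀ (i i' : Fin iM) (j j' : Fin nM) (s s' : Fin iU),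
      (Γ : Set P) * {g * u s * h j * m i} = (Γ : Set P) * {g * u s' * h j' * m i'} →
      i = i' ∧ j = j' ∧ s = s') := by
  have hprΓ : ∀ x ∈ Γ, prM x ∈ Γ ⊓ M := by
    intro x hx
    obtain ⟨a, ha, b, hb, rfl⟩ : x ∈ ((Γ ⊓ M : Subgroup P) : Set P) * ((Γ ⊓ U : Subgroup P) : Set P) :=
      hΓ ▸ hx
    rw [map_mul, hprM_fix a ha.2, hprM_U b hb.2, mul_one]
    exact ha
  have hkerΓ : ∀ x ∈ Γ, prM x = 1 → x ∈ Γ ⊓ U := by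
    intro x hx hx1
    obtain ⟨a, ha, b, hb, rfl⟩ : x ∈ ((Γ ⊓ M : Subgroup P) : Set P) * ((Γ ⊓ U : Subgroup P) : Set P) :=
      hΓ ▸ hx
    have ha1 : a = 1 := by
      rwa [map_mul, hprM_fix a ha.2, hprM_U b hb.2, mul_one] at hx1
    simpa [ha1] using hb
  refine ⟨?_, ?_⟩
  · ext x
    simp only [Set.mul_singleton, Set.mem_mul, Set.mem_iUnion, Set.mem_image, SetLike.mem_coe]
    constructor
    · rintro ⟨_, ⟨δ, hδ, rfl⟩, γ, hγ, rfl⟩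
      have h₁ : prM γ ∈ ((Γ ⊓ M : Subgroup P) : Set P) := hprΓ γ hγ
      rw [hmcov] at h₁
      obtain ⟨i, y, hy, hyi⟩ := Set.mem_iUnion.1 h₁
      rw [hhcov] at hy
      obtain ⟨j, _, ⟨z, ⟨hz, hgz⟩, rfl⟩, rfl⟩ := Set.mem_iUnion.1 hy
      have hw : z⁻¹ * γ * (m i)⁻¹ * (h j)⁻¹ ∈ ((Γ ⊓ U : Subgroup P) : Set P) := by
        refine hkerΓ _ (mul_mem (mul_mem (mul_mem (inv_mem hz) hγ) (inv_mem (hm i).1))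
          (inv_mem (hh j).1.1)) ?_
        simp only [map_mul, map_inv, hprM_fix _ (hm i).2, hprM_fix _ (hh j).1.2, ← hyi]
        group
      rw [hucov] at hw
      obtain ⟨s, w, ⟨_, hgw⟩, hws⟩ := Set.mem_iUnion.1 hw
      refine ⟨i, j, s, δ * ((g * z * g⁻¹) * (g * w * g⁻¹)), mul_mem hδ (mul_mem hgz hgw.1), ?_⟩
      have hγ' : γ = z * (w * u s) * h j * m i := by
        simp only at hws
        rw [hws]
        group
      rw [hγ']
      group
    · rintro ⟨i, j, s, δ, hδ, rfl⟩
      exact ⟨δ * g, ⟨δ, hδ, rfl⟩, u s * h j * m i,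
        mul_mem (mul_mem (hu s).1 (hh j).1.1) (hm i).1, by group⟩
  · intro i i' j j' s s' heq
    have hmem : g * u s * h j * m i ∈ (Γ : Set P) * {g * u s' * h j' * m i'} :=
      heq ▸ ⟨1, Γ.one_mem, _, rfl, one_mul _⟩
    obtain ⟨γ, hγ, _, rfl, hγeq⟩ := hmem
    simp only at hγeq
    obtain ⟨z, rfl⟩ : ∃ z, γ = g * z * g⁻¹ := ⟨g⁻¹ * γ * g, by group⟩
    have key : z * u s' * h j' * m i' = u s * h j * m i := by
      apply mul_left_cancel (a := g)
      simpa [mul_assoc] using hγeq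
    have hz : z ∈ Γ := by
      have hz_eq : z = u s * h j * m i * (u s' * h j' * m i')⁻¹ := by
        rw [← key]
        group
      rw [hz_eq]
      exact mul_mem (mul_mem (mul_mem (hu s).1 (hh j).1.1) (hm i).1)
        (inv_mem (mul_mem (mul_mem (hu s').1 (hh j').1.1) (hm i').1))
    have hpr : prM z * h j' * m i' = h j * m i := by
      have := congrArg prM key
      simpa only [map_mul, hprM_U _ (hu _).2, hprM_fix _ (hm _).2, hprM_fix _ (hh _).1.2,
        mul_one, one_mul] using this
    have hprz : prM z * h j' ∈ {x : P | x ∈ Γ ⊓ M ∧ prM g * x * (prM g)⁻¹ ∈ Γ ⊓ M} := by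
      refine ⟨mul_mem (hprΓ z hz) (hh j').1, ?_⟩
      have := mul_mem (hprΓ _ hγ) (hh j').2
      simpa [mul_assoc] using this
    obtain rfl := hmdisj i' i _ _ hprz (hh j) hpr
    have hpr' : prM z * h j' = h j := mul_right_cancel hpr
    obtain rfl := hhdisj j' j (prM z) 1 ⟨z, ⟨hz, hγ⟩, rfl⟩
      ⟨1, ⟨Γ.one_mem, by simp⟩, map_one _⟩ (by rw [hpr', one_mul])
    have hzU : z ∈ Γ ⊓ U := hkerΓ z hz (mul_eq_right.1 hpr')
    have hu' : z * u s' = u s := mul_right_cancel (mul_right_cancel key)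
    refine ⟨rfl, rfl, hudisj s s' 1 z ⟨one_mem _, by simp⟩
      ⟨hzU, hγ, ‹U.Normal›.conj_mem z hzU.2 g⟩ (by rw [hu', one_mul])⟩
end

section
/- Assume the following condition: for every 1 ≤ i ≤ N and every (x_1,…,x_{i−1}) ∈ X_1 × ⋯ × X_{i−1} there exists z ∈ X_i, depending only on (x_1,…,x_{i−1}), such that whenever an element y_1⋯y_N of Y (with y_j ∈ X_j for all j) satisfies y_j = x_j for all 1 ≤ j ≤ i−1, one has y_i ∈ z·Z_i. Then |Y| ≤ ∏_{i=1}^{N} |Z_i|. -/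
open Pointwise

/-- counting lemma.  `X` a finite group, `X_1, …, X_N`
subgroups with bijective multiplication map, `Y ≤ X`, `Z_i ≤ X_i`.  If for
every `i` and every `(x_1, …, x_{i-1})` there is `z ∈ X_i`, depending only on
`(x_1, …, x_{i-1})`, such that every `y_1⋯y_N ∈ Y` (with `y_j ∈ X_j`)
satisfying `y_j = x_j` for `j < i` has `y_i ∈ z·Z_i`, then
`|Y| ≤ ∏ᵢ |Z_i|`. -/
theorem stmt_6 (X : Type*) [Group X] [Finite X] (N : ℕ)
    (Xs : Fin N → Subgroup X)
    (hprod : Function.Bijective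
      (fun x : (i : Fin N) → (Xs i) => (List.ofFn fun i => (x i : X)).prod))
    (Y : Subgroup X) (Z : Fin N → Subgroup X) (hZ : ∀ i, Z i ≤ Xs i)
    (hcond : ∀ i : Fin N, ∀ x : Fin N → X, (∀ j, x j ∈ Xs j) →
      ∃ z ∈ Xs i, ∀ y : Fin N → X, (∀ j, y j ∈ Xs j) →
        (List.ofFn y).prod ∈ Y → (∀ j, j < i → y j = x j) → z⁻¹ * y i ∈ Z i) :
    Nat.card Y ≤ ∏ i : Fin N, Nat.card (Z i) := by
  classical
  choose! z _ hz using hcond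
  choose x hx using fun y : Y => hprod.2 (y : X)
  let c : Y → Fin N → X := fun y j => x y j
  have hc : ∀ y j, c y j ∈ Xs j := fun y j => (x y j).2
  have hcprod : ∀ y, (List.ofFn (c y)).prod = (y : X) := hx
  let t : Fin N → Y → Fin N → X := fun i y j => if j < i then c y j else 1
  have ht : ∀ i y j, t i y j ∈ Xs j := by
    intro i y j
    by_cases h : j < i
    · simpa [t, h] using hc y j
    · simp [t, h]
  have hmem : ∀ i y, (z i (t i y))⁻¹ * c y i ∈ Z i := fun i y =>
    hz i (t i y) (ht i y) (c y) (hc y) (by rw [hcprod]; exact y.2)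
      fun j hj => by simp [t, hj]
  let f : Y → (i : Fin N) → Z i := fun y i => ⟨(z i (t i y))⁻¹ * c y i, hmem i y⟩
  have hf : Function.Injective f := by
    intro y y' h
    have key : ∀ i, c y i = c y' i := by
      intro i
      induction i using WellFoundedLT.induction with
      | ind i ih =>
        have htt : t i y = t i y' := by
          funext j
          by_cases hj : j < i
          · simpa [t, hj] using ih j hj
          · simp [t, hj]
        have hi : (z i (t i y))⁻¹ * c y i = (z i (t i y'))⁻¹ * c y' i :=
          congrArg Subtype.val (congrFun h i)
        rw [htt] at hi
        exact mul_left_cancel hi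
    apply Subtype.ext
    rw [← hcprod y, ← hcprod y', funext key]
  rw [← Nat.card_pi]
  exact Nat.card_le_card_of_injective f hf
end

section
/- Set U := ⟨Y_α : α ∈ Ψ⟩, the subgroup of X generated by all the Y_α. Then for every g ∈ U, every α ∈ Ψ, and every x ∈ Y_α, the element g⁻¹·x·g·x⁻¹ lies in the subgroup of X generated by the Y_β with β ∈ Ψ and β > α. -/
open Pointwise

/-- Conjugation by elements of a biSupremum of subgroups preserves `N` as soon as conjugation by
elements of each of them does. -/
theorem Subgroup.conj_mem_of_mem_biSup {ι X : Type*} [Group X] {Y : ι → Subgroup X} {s : Set ι}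
    {N : Subgroup X} (h : ∀ i ∈ s, ∀ g ∈ Y i, ∀ n ∈ N, g⁻¹ * n * g ∈ N)
    {g : X} (hg : g ∈ ⨆ i ∈ s, Y i) : ∀ n ∈ N, g⁻¹ * n * g ∈ N := by
  rw [iSup_subtype'] at hg
  induction hg using Subgroup.iSup_induction' with
  | hp i g hg => exact h i i.2 g hg
  | h1 => simp
  | hmul a b _ _ iha ihb =>
    intro n hn
    simpa [mul_assoc] using ihb _ (iha n hn)

/-- If conjugation by every `Y i` preserves `N` and fixes `x` modulo `N`, the same holds for their
supremum. -/
theorem Subgroup.conj_mul_inv_mem_of_mem_biSup {ι X : Type*} [Group X] {Y : ι → Subgroup X}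
    {s : Set ι} {N : Subgroup X} (hN : ∀ i ∈ s, ∀ g ∈ Y i, ∀ n ∈ N, g⁻¹ * n * g ∈ N) {x : X}
    (hx : ∀ i ∈ s, ∀ g ∈ Y i, g⁻¹ * x * g * x⁻¹ ∈ N)
    {g : X} (hg : g ∈ ⨆ i ∈ s, Y i) : g⁻¹ * x * g * x⁻¹ ∈ N := by
  rw [iSup_subtype'] at hg
  induction hg using Subgroup.iSup_induction' with
  | hp i g hg => exact hx i i.2 g hg
  | h1 => simp
  | hmul a b _ hb iha ihb =>
    rw [← iSup_subtype' (f := fun i _ => Y i)] at hb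
    simpa [mul_assoc] using mul_mem (conj_mem_of_mem_biSup hN hb _ iha) ihb

/-- It suffices to check that conjugation by `g` sends generators of a biSupremum into it. -/
theorem Subgroup.conj_mem_biSup {ι X : Type*} [Group X] {Y : ι → Subgroup X} {s : Set ι} {g : X}
    (h : ∀ i ∈ s, ∀ y ∈ Y i, g⁻¹ * y * g ∈ ⨆ i ∈ s, Y i) :
    ∀ n ∈ ⨆ i ∈ s, Y i, g⁻¹ * n * g ∈ ⨆ i ∈ s, Y i := by
  have : ⨆ i ∈ s, Y i ≤ (⨆ i ∈ s, Y i).comap (MulAut.conj g⁻¹).toMonoidHom :=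
    iSup₂_le fun i hi y hy => by simpa using h i hi y hy
  intro n hn
  simpa using this hn

/-- With `U := ⟨Y_α : α ∈ Ψ⟩`, for every `g ∈ U`, `α ∈ Ψ`,
and `x ∈ Y_α`, the commutator `g⁻¹·x·g·x⁻¹` lies in the subgroup generated by
the `Y_β` with `β ∈ Ψ` and `β > α`. -/
theorem stmt_8 (V : Type*) [AddCommGroup V] [Module ℝ V]
    (Ψ : Finset (Module.Dual ℝ V)) (v₀ : V) (hv₀ : ∀ α ∈ Ψ, α v₀ > 0)
    (le : Module.Dual ℝ V → Module.Dual ℝ V → Prop)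
    (hle : ∀ α β : Module.Dual ℝ V, le α β ↔
      ∃ (r : ℕ) (s : Module.Dual ℝ V → ℕ), 0 < r ∧
        β = (r : ℝ) • α + ∑ γ ∈ Ψ, (s γ : ℝ) • γ)
    (X : Type*) [Group X] (Y : Module.Dual ℝ V → Subgroup X)
    (hcomm : ∀ α ∈ Ψ, ∀ β ∈ Ψ,
      ⁅Y α, Y β⁆ ≤ ⨆ γ ∈ {γ : Module.Dual ℝ V | γ ∈ Ψ ∧
        ∃ r s : ℕ, 0 < r ∧ 0 < s ∧ γ = (r : ℝ) • α + (s : ℝ) • β}, Y γ)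
    (g : X) (hg : g ∈ ⨆ α ∈ Ψ, Y α)
    (α : Module.Dual ℝ V) (hα : α ∈ Ψ) (x : X) (hx : x ∈ Y α) :
    g⁻¹ * x * g * x⁻¹ ∈
      ⨆ β ∈ {β : Module.Dual ℝ V | β ∈ Ψ ∧ le α β ∧ α ≠ β}, Y β := by
  classical
  have le_comb : ∀ a b : Module.Dual ℝ V, b ∈ Ψ → ∀ r s : ℕ, 0 < s →
      le a ((r : ℝ) • b + (s : ℝ) • a) := by
    intro a b hb r s hs
    refine (hle _ _).2 ⟨s, fun γ => if γ = b then r else 0, hs, ?_⟩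
    simp [ite_smul, hb, add_comm]
  have le_trans' : ∀ a b c : Module.Dual ℝ V, le a b → le b c → le a c := by
    intro a b c hab hbc
    obtain ⟨r, s, hr, rfl⟩ := (hle _ _).1 hab
    obtain ⟨r', s', hr', rfl⟩ := (hle _ _).1 hbc
    refine (hle _ _).2 ⟨r' * r, fun γ => r' * s γ + s' γ, Nat.mul_pos hr' hr, ?_⟩
    simp only [Nat.cast_mul, Nat.cast_add, add_smul, mul_smul, Finset.sum_add_distrib, smul_add,
      Finset.smul_sum, add_assoc]
  have le_eval : ∀ a ∈ Ψ, ∀ b, le a b → a v₀ ≤ b v₀ := by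
    intro a ha b hab
    obtain ⟨r, s, hr, rfl⟩ := (hle _ _).1 hab
    have h1 : (1 : ℝ) ≤ r := by exact_mod_cast hr
    have h2 : 0 ≤ ∑ γ ∈ Ψ, (s γ : ℝ) * γ v₀ :=
      Finset.sum_nonneg fun γ hγ => mul_nonneg (Nat.cast_nonneg _) (hv₀ γ hγ).le
    simp only [LinearMap.add_apply, LinearMap.smul_apply, LinearMap.sum_apply, smul_eq_mul]
    nlinarith [hv₀ a ha]
  have key : ∀ a ∈ Ψ, ∀ b ∈ Ψ, le a b → ∀ c ∈ Ψ, ∀ y ∈ Y b, ∀ h ∈ Y c,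
      h⁻¹ * y * h * y⁻¹ ∈ ⨆ β ∈ {β : Module.Dual ℝ V | β ∈ Ψ ∧ le a β ∧ a ≠ β}, Y β := by
    intro a ha b hb hab c hc y hy h hh
    have hmem : h⁻¹ * y * h * y⁻¹ ∈ ⁅Y c, Y b⁆ := by
      simpa [commutatorElement_def] using Subgroup.commutator_mem_commutator (inv_mem hh) hy
    refine (hcomm c hc b hb).trans (iSup₂_le ?_) hmem
    rintro γ ⟨hγ, r, s, hr, hs, rfl⟩
    refine le_biSup Y (i := (r : ℝ) • c + (s : ℝ) • b)
      ⟨hγ, le_trans' _ _ _ hab (le_comb b c hc r s hs), fun heq => ?_⟩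
    have h1 : (1 : ℝ) ≤ r := by exact_mod_cast hr
    have h2 : (1 : ℝ) ≤ s := by exact_mod_cast hs
    have h3 := congrArg (fun f => f v₀) heq
    simp only [LinearMap.add_apply, LinearMap.smul_apply, smul_eq_mul] at h3
    nlinarith [hv₀ c hc, hv₀ b hb, le_eval a ha b hab]
  have le_refl' : le α α := (hle _ _).2 ⟨1, 0, one_pos, by simp⟩
  refine Subgroup.conj_mul_inv_mem_of_mem_biSup (s := (Ψ : Set (Module.Dual ℝ V))) ?_
    (fun c hc h hh => key α hα α hα le_refl' c hc x hx h hh) (by simpa using hg)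
  refine fun c hc h hh => Subgroup.conj_mem_biSup fun b hb y hy => ?_
  simpa using mul_mem (key α hα b hb.1 hb.2.1 c hc y hy h hh) (le_biSup Y hb hy)
end

section
/- Let R be a commutative unital ring, A an associative unital R-algebra, A⁺ an R-subalgebra of A, and t ∈ A⁺ an element that is central in A, invertible in A, and such that for every a ∈ A there exists n ∈ ℤ_{>0} with tⁿ·a ∈ A⁺. Let B be an associative unital R-algebra and φ⁺ : A⁺ → B an R-algebra homomorphism. Then φ⁺ extends to an R-algebra homomorphism φ : A → B if and only if φ⁺(t) is invertible in B; moreover, if an extension exists, it is unique. -/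
/-- An algebra homomorphism on a subalgebra `S` extends to `A` as soon as it sends to a unit some
`t ∈ S` that is central in `A` and whose powers multiply every element of `A` into `S`. -/
theorem Subalgebra.exists_algHom_extension_of_isUnit {R A B : Type*} [CommRing R] [Ring A]
    [Algebra R A] [Ring B] [Algebra R B] {S : Subalgebra R A} {t : S}
    (hcomm : ∀ a : A, Commute (t : A) a) (hloc : ∀ a : A, ∃ n : ℕ, (t : A) ^ n * a ∈ S)
    (ψ : S →ₐ[R] B) (hu : IsUnit (ψ t)) :
    ∃ φ : A →ₐ[R] B, ∀ x : S, φ (x : A) = ψ x := by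
  have hval : ∀ a : A, ∃ b : B, ∀ (n : ℕ) (x : S), (x : A) = (t : A) ^ n * a →
      ψ t ^ n * b = ψ x := by
    intro a
    obtain ⟨m, hm⟩ := hloc a
    obtain ⟨b, hb⟩ := (hu.pow m).dvd (a := ψ ⟨_, hm⟩)
    refine ⟨b, fun n x hx => (hu.pow m).mul_left_cancel ?_⟩
    rw [← mul_assoc, ← pow_add, add_comm, pow_add, mul_assoc, ← hb, ← map_pow, ← map_pow,
      ← map_mul, ← map_mul]
    congr 1
    ext
    simp only [MulMemClass.coe_mul, SubmonoidClass.coe_pow, hx]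
    rw [← mul_assoc, ← mul_assoc, ← pow_add, ← pow_add, add_comm]
  choose f hf using hval
  have hf_unique : ∀ (a : A) (b : B) (n : ℕ) (x : S), (x : A) = (t : A) ^ n * a →
      ψ t ^ n * b = ψ x → f a = b := fun a b n x hx hb =>
    (hu.pow n).mul_left_cancel ((hf a n x hx).trans hb.symm)
  have hf_coe : ∀ x : S, f x = ψ x := fun x =>
    hf_unique x (ψ x) 0 x (by simp) (by simp)
  have hf_algebraMap : ∀ r : R, f (algebraMap R A r) = algebraMap R B r := fun r =>
    (hf_coe (algebraMap R S r)).trans (ψ.commutes r)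
  have hf_mul : ∀ a b : A, f (a * b) = f a * f b := by
    intro a b
    obtain ⟨n, hn⟩ := hloc a
    obtain ⟨m, hm⟩ := hloc b
    have hc : Commute (ψ t ^ m) (f a) := by
      have h : Commute (ψ t) (f a) := by
        refine (hu.pow n).mul_left_cancel ?_
        have ht : Commute t (⟨_, hn⟩ : S) := Subtype.ext (hcomm _)
        rw [← mul_assoc, ← pow_succ, pow_succ', mul_assoc, ← mul_assoc (ψ t ^ n),
          hf a n ⟨_, hn⟩ rfl]
        exact ht.map ψ
      exact h.pow_left m
    refine hf_unique _ _ (n + m) (⟨_, hn⟩ * ⟨_, hm⟩) ?_ ?_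
    · simp only [MulMemClass.coe_mul]
      rw [pow_add, mul_assoc, mul_assoc, ← mul_assoc _ a b,
        ((hcomm a).pow_left m).eq, mul_assoc]
    · rw [map_mul, ← hf a n ⟨_, hn⟩ rfl, ← hf b m ⟨_, hm⟩ rfl, pow_add, mul_assoc, mul_assoc,
        ← mul_assoc _ (f a), hc.eq, mul_assoc]
  have hf_add : ∀ a b : A, f (a + b) = f a + f b := by
    intro a b
    obtain ⟨n, hn⟩ := hloc a
    obtain ⟨m, hm⟩ := hloc b
    have ha : ((t ^ m * ⟨_, hn⟩ : S) : A) = (t : A) ^ (m + n) * a := by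
      simp [pow_add, mul_assoc]
    have hb : ((t ^ n * ⟨_, hm⟩ : S) : A) = (t : A) ^ (m + n) * b := by
      simp [add_comm m, pow_add, mul_assoc]
    refine hf_unique _ _ (m + n) (t ^ m * ⟨_, hn⟩ + t ^ n * ⟨_, hm⟩) ?_ ?_
    · rw [AddMemClass.coe_add, ha, hb, mul_add]
    · rw [mul_add, hf a _ _ ha, hf b _ _ hb, map_add]
  exact ⟨{ toFun := f
           map_one' := by simpa using hf_algebraMap 1
           map_mul' := hf_mul
           map_zero' := by simpa using hf_algebraMap 0
           map_add' := hf_add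
           commutes' := hf_algebraMap }, hf_coe⟩

/-- Let `A⁺ ⊆ A` be an `R`-subalgebra and `t ∈ A⁺` a central
unit of `A` such that `A` is the localization of `A⁺` at `t` (i.e. for every
`a ∈ A` there is `n > 0` with `tⁿ·a ∈ A⁺`).  An `R`-algebra homomorphism
`φ⁺ : A⁺ → B` extends to `A` if and only if `φ⁺(t)` is invertible in `B`, and
an extension, if it exists, is unique. -/
theorem stmt_10 (R : Type*) [CommRing R] (A : Type*) [Ring A] [Algebra R A]
    (B : Type*) [Ring B] [Algebra R B]
    (Aplus : Subalgebra R A) (t : A) (htmem : t ∈ Aplus)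
    (htcentral : ∀ a : A, Commute t a) (htunit : IsUnit t)
    (htloc : ∀ a : A, ∃ n : ℕ, 0 < n ∧ t ^ n * a ∈ Aplus)
    (φplus : Aplus →ₐ[R] B) :
    ((∃ φ : A →ₐ[R] B, ∀ x : Aplus, φ (x : A) = φplus x) ↔
      IsUnit (φplus ⟨t, htmem⟩)) ∧
    (∀ φ φ' : A →ₐ[R] B, (∀ x : Aplus, φ (x : A) = φplus x) →
      (∀ x : Aplus, φ' (x : A) = φplus x) → φ = φ') := by
  refine ⟨⟨?_, fun hu => Subalgebra.exists_algHom_extension_of_isUnit htcentral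
    (fun a => (htloc a).imp fun _ h => h.2) φplus hu⟩, ?_⟩
  · rintro ⟨φ, hφ⟩
    exact hφ ⟨t, htmem⟩ ▸ htunit.map φ
  · intro φ φ' hφ hφ'
    ext a
    obtain ⟨n, -, hn⟩ := htloc a
    refine ((htunit.map φ).pow n).mul_left_cancel ?_
    have ht : φ t = φ' t := (hφ ⟨t, htmem⟩).trans (hφ' ⟨t, htmem⟩).symm
    have h : φ (t ^ n * a) = φ' (t ^ n * a) := (hφ ⟨_, hn⟩).trans (hφ' ⟨_, hn⟩).symm
    rwa [map_mul, map_mul, map_pow, map_pow, ← ht] at h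
end
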